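/- Let N be an odd natural number with N ≥ 1 and let h, n : ZMod N → ℝ be real-valued signals, regarded as complex signals via ℝ ↪ ℂ. Then for every k in {0,…,N−1}, (h ⋆ n)(k) = (1/N) · ( (dft h)(0) · (dft n)(0) ).re + (2/N) · ∑_{l=1}^{(N−1)/2} Re( exp(2πi·k·l/N) · (dft h)(l) · (dft n)(l) ). That is, using conjugate symmetry of real spectra, the N frequency terms pair up into the DC term plus twice the real parts of the first (N−1)/2 modulated product terms, turning the reconstruction into a sum of cosine-type Fourier features with real coefficients. -/

import Mathlib

open Complex Finset

/-- Discrete Fourier transform of a signal of length `N`: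
`(dft x) l = ∑ k, x k * exp(-2πi·k·l/N)`. -/
noncomputable def dft {N : ℕ} [NeZero N] (x : ZMod N → ℂ) : ZMod N → ℂ :=
  fun l => ∑ k : ZMod N,
    x k * Complex.exp (-2 * Real.pi * Complex.I * (k.val : ℂ) * (l.val : ℂ) / (N : ℂ))

/-- Circular convolution: `(h ⋆ n) k = ∑ j, h j * n (k - j)`. -/
noncomputable def cconv {N : ℕ} [NeZero N] (h n : ZMod N → ℂ) : ZMod N → ℂ :=
  fun k => ∑ j : ZMod N, h j * n (k - j)

/-- The defining exponential sum of `dft`, in terms of the standard additive character. -/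
theorem dft_apply_eq_sum_stdAddChar {N : ℕ} [NeZero N] (x : ZMod N → ℂ) (l : ZMod N) :
    dft x l = ∑ k : ZMod N, x k * ZMod.stdAddChar (-(k * l)) := by
  refine Finset.sum_congr rfl fun k _ => ?_
  have hkl : -(k * l) = ((-(k.val * l.val : ℤ) : ℤ) : ZMod N) := by simp
  rw [hkl, ZMod.stdAddChar_coe]
  congr 2
  push_cast
  ring

/-- `dft` is Mathlib's discrete Fourier transform. -/
theorem dft_eq_zmod_dft {N : ℕ} [NeZero N] (x : ZMod N → ℂ) : dft x = ZMod.dft x := by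
  ext l
  simp only [dft_apply_eq_sum_stdAddChar, ZMod.dft_apply, smul_eq_mul, mul_comm]

/-- Fourier inversion. -/
theorem eq_inv_mul_sum_stdAddChar_mul_dft {N : ℕ} [NeZero N] (x : ZMod N → ℂ) (k : ZMod N) :
    x k = (N : ℂ)⁻¹ * ∑ l : ZMod N, ZMod.stdAddChar (l * k) * dft x l := by
  have hinv := ZMod.invDFT_apply (ZMod.dft x) k
  rw [LinearEquiv.symm_apply_apply] at hinv
  simpa only [dft_eq_zmod_dft, smul_eq_mul] using hinv

/-- The convolution theorem. -/
theorem dft_cconv {N : ℕ} [NeZero N] (x y : ZMod N → ℂ) (l : ZMod N) :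
    dft (cconv x y) l = dft x l * dft y l := by
  simp only [dft_apply_eq_sum_stdAddChar, cconv, Finset.sum_mul]
  rw [Finset.sum_comm]
  refine Finset.sum_congr rfl fun j _ => ?_
  rw [← Equiv.sum_comp (Equiv.addRight j), Finset.mul_sum]
  refine Finset.sum_congr rfl fun i _ => ?_
  rw [Equiv.coe_addRight, add_sub_cancel_right, add_mul, neg_add, AddChar.map_add_eq_mul]
  ring

/-- The spectrum of a real signal is conjugate symmetric. -/
theorem dft_ofReal_neg {N : ℕ} [NeZero N] (x : ZMod N → ℝ) (l : ZMod N) :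
    dft (fun j => (x j : ℂ)) (-l) = starRingEnd ℂ (dft (fun j => (x j : ℂ)) l) := by
  simp only [dft_apply_eq_sum_stdAddChar, map_sum, map_mul, Complex.conj_ofReal,
    ← AddChar.map_neg_eq_conj, mul_neg]

/-- For odd `N`, the nonzero residues split into the pairs `{l, -l}` with `1 ≤ l ≤ (N - 1) / 2`. -/
theorem ZMod.sum_eq_zero_add_sum_Icc_add_neg {M : Type*} [AddCommMonoid M] {N : ℕ} [NeZero N]
    (hodd : Odd N) (f : ZMod N → M) :
    ∑ l : ZMod N, f l = f 0 + ∑ l ∈ Finset.Icc 1 ((N - 1) / 2), (f l + f (-l)) := by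
  obtain ⟨m, rfl⟩ := hodd
  have hrange : ∑ l : ZMod (2 * m + 1), f l = ∑ i ∈ Finset.range (m + m + 1), f i := by
    rw [← two_mul, ← Fin.sum_univ_eq_sum_range (fun i => f (i : ZMod (2 * m + 1)))]
    exact Finset.sum_congr rfl fun l _ => congrArg f (ZMod.natCast_zmod_val l).symm
  have hIcc : Finset.Icc 1 ((2 * m + 1 - 1) / 2) = Finset.Ico (0 + 1) (m + 1) := by
    ext i
    simp only [Finset.mem_Icc, Finset.mem_Ico]
    omega
  rw [hrange, Finset.sum_range_succ', add_comm, Nat.cast_zero, Finset.sum_range_add, hIcc,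
    ← Finset.sum_Ico_add', ← Finset.range_eq_Ico, Finset.sum_add_distrib,
    ← Finset.sum_range_reflect (fun i => f ((m + i + 1 : ℕ) : ZMod (2 * m + 1)))]
  congr 2
  refine Finset.sum_congr rfl fun i hi => congrArg f ?_
  have hi' := Finset.mem_range.mp hi
  rw [eq_neg_iff_add_eq_zero, ← Nat.cast_add,
    show m + (m - 1 - i) + 1 + (i + 1) = 2 * m + 1 by omega, ZMod.natCast_self]

/-- For real signals and odd `N`, the frequency terms pair up into the DC term
plus twice the real parts of the first `(N-1)/2` modulated product terms:
a cosine-type Fourier feature expansion of the convolution output. -/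
theorem cconv_eq_dc_add_cosine_expansion (N : ℕ) [NeZero N] (hodd : Odd N)
    (h n : ZMod N → ℝ) (k : ZMod N) :
    cconv (fun j => ((h j : ℂ))) (fun j => ((n j : ℂ))) k =
      ((((1 / (N : ℝ)) *
          (dft (fun j => ((h j : ℂ))) 0 * dft (fun j => ((n j : ℂ))) 0).re
        + (2 / (N : ℝ)) * ∑ l ∈ Finset.Icc 1 ((N - 1) / 2),
            (Complex.exp (2 * Real.pi * Complex.I * (k.val : ℂ) * (l : ℂ) / (N : ℂ)) *
              dft (fun j => ((h j : ℂ))) (l : ZMod N) *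
              dft (fun j => ((n j : ℂ))) (l : ZMod N)).re) : ℝ) : ℂ) := by
  set H := dft fun j => (h j : ℂ) with hH
  set G := dft fun j => (n j : ℂ) with hG
  have hneg (l : ZMod N) : ZMod.stdAddChar (-l * k) * (H (-l) * G (-l)) =
      starRingEnd ℂ (ZMod.stdAddChar (l * k) * (H l * G l)) := by
    simp only [hH, hG, dft_ofReal_neg, map_mul, neg_mul, AddChar.map_neg_eq_conj]
  have hzero : (((H 0 * G 0).re : ℝ) : ℂ) = H 0 * G 0 := by
    rw [← Complex.conj_eq_iff_re, map_mul, hH, hG, ← dft_ofReal_neg, ← dft_ofReal_neg, neg_zero]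
  have hexp (l : ℕ) : Complex.exp (2 * Real.pi * Complex.I * (k.val : ℂ) * (l : ℂ) / (N : ℂ)) =
      ZMod.stdAddChar ((l : ZMod N) * k) := by
    have hlk : (l : ZMod N) * k = ((l * k.val : ℤ) : ZMod N) := by simp
    rw [hlk, ZMod.stdAddChar_coe]
    congr 1
    push_cast
    ring
  rw [eq_inv_mul_sum_stdAddChar_mul_dft (cconv _ _) k]
  simp only [dft_cconv, ← hH, ← hG]
  rw [ZMod.sum_eq_zero_add_sum_Icc_add_neg hodd]
  simp only [hneg, Complex.add_conj, hexp]
  simp only [mul_assoc]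
  push_cast
  rw [hzero, ← Finset.mul_sum, zero_mul, AddChar.map_zero_eq_one]
  ring
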